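/- arXiv:math/0607659 — 2 statements merged into one kernel-verified Lean document; each statement's English description precedes it below -/
import Mathlib

section
/- Let m ∈ ℝ, ρ > 0, δ ≥ 0 and let σ ∈ S^m_{ρ,δ}. For x ∈ ℝⁿ, z ∈ ℝⁿ with z ≠ 0, and any nonnegative integer L with m − 2Lρ < −n, the function ξ ↦ (−Δ_ξ)^L σ(x,ξ) is absolutely integrable, the quantity k(x,z) = (2π)^{−n} |z|^{−2L} ∫_{ℝⁿ} e^{i z·ξ} (−Δ_ξ)^L σ(x,ξ) dξ is independent of the choice of such L, and k is a smooth function of (x,z) on {z ≠ 0}. Moreover, for all multi-indices α, β ∈ ℕⁿ and every N > 0 there exists a constant C_{α,β,N} such that |∂_x^α ∂_z^β k(x,z)| ≤ C_{α,β,N} (1+|z|)^{−N} for all x ∈ ℝⁿ and all z with |z| ≥ 1/2. -/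
open MeasureTheory Complex
open scoped RealInnerProductSpace ENNReal NNReal

noncomputable section

abbrev En (n : ℕ) : Type := EuclideanSpace ℝ (Fin n)

/-- Image of an integer vector `k ∈ ℤⁿ` in `ℝⁿ`. -/
def intVec (n : ℕ) (k : Fin n → ℤ) : En n :=
  (EuclideanSpace.equiv (Fin n) ℝ).symm fun i => (k i : ℝ)

/-- The unit coordinate vector `eᵢ` of `ℝⁿ`. -/
def unitE (n : ℕ) (i : Fin n) : En n := EuclideanSpace.single i 1

/-- Iterated directional (partial) derivative along the list of directions `L`. -/
def pdSeq {V : Type*} [NormedAddCommGroup V] [NormedSpace ℝ V] (L : List V) (f : V → ℂ) :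
    V → ℂ :=
  L.foldr (fun v g => fun x => fderiv ℝ g x v) f

/-- The list of directions encoding the multi-index `α`: direction `dir i` repeated `α i`
times. -/
def dirList {V : Type*} {n : ℕ} (α : Fin n → ℕ) (dir : Fin n → V) : List V :=
  (List.ofFn fun i => List.replicate (α i) (dir i)).flatten

/-- The mixed partial derivative `∂_x^α ∂_ξ^β σ` of a symbol `σ(x,ξ)` on `ℝⁿ × ℝⁿ`. -/
def mixD (n : ℕ) (α β : Fin n → ℕ) (σ : En n × En n → ℂ) : En n × En n → ℂ :=
  pdSeq (dirList α (fun i => (unitE n i, (0 : En n))) ++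
    dirList β (fun i => ((0 : En n), unitE n i))) σ

/-- The Hörmander class `S^m_{ρ,δ}`: `σ` is smooth and
`|∂_x^α ∂_ξ^β σ(x,ξ)| ≤ C_{α,β} (1+|ξ|)^{m − ρ|β| + δ|α|}`. -/
def IsHormander (n : ℕ) (m ρ δ : ℝ) (σ : En n × En n → ℂ) : Prop :=
  ContDiff ℝ (⊤ : ℕ∞) σ ∧
  ∀ α β : Fin n → ℕ, ∃ C : ℝ, ∀ x ξ : En n,
    ‖mixD n α β σ (x, ξ)‖ ≤
      C * (1 + ‖ξ‖) ^ (m - ρ * (∑ i, (β i : ℝ)) + δ * (∑ i, (α i : ℝ)))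

/-- The difference operator `Δ_h g(X) = g(X+h) − g(X)`. -/
def idiff {V : Type*} [Add V] (h : V) (g : V → ℂ) : V → ℂ := fun X => g (X + h) - g X

/-- The Besov `B^{α,∞}_∞` norm (valued in `ℝ≥0∞`):
`‖g‖_∞ + sup_{h≠0} |h|^{−α} ‖Δ_h^{α+1} g‖_∞`. -/
def besovE (n : ℕ) (α : ℕ) (g : En n → ℂ) : ℝ≥0∞ :=
  (⨆ x, (‖g x‖₊ : ℝ≥0∞)) +
    ⨆ (h : En n) (_ : h ≠ 0),
      ((‖h‖₊ : ℝ≥0∞) ^ (α : ℝ))⁻¹ * ⨆ x, (‖(idiff h)^[α + 1] g x‖₊ : ℝ≥0∞)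

/-- The partial derivative `∂_ξ^β σ` in the `ξ`-variables only. -/
def xiD (n : ℕ) (β : Fin n → ℕ) (σ : En n × En n → ℂ) : En n → En n → ℂ :=
  fun x => pdSeq (dirList β (unitE n)) (fun ξ => σ (x, ξ))

/-- The class `S̃^m_{ρ,δ}`: `σ(x,ξ)` is smooth in `ξ`, its `ξ`-derivatives are continuous,
and `‖∂_ξ^β σ(·,ξ)‖_{B^{α,∞}_∞} ≤ C_{α,β} (1+|ξ|)^{m − ρ|β| + δα}` (the Besov norm taken in
the `x`-variable). -/
def IsTilde (n : ℕ) (m ρ δ : ℝ) (σ : En n × En n → ℂ) : Prop :=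
  (∀ x : En n, ContDiff ℝ (⊤ : ℕ∞) fun ξ => σ (x, ξ)) ∧
  (∀ β : Fin n → ℕ, Continuous fun X : En n × En n => xiD n β σ X.1 X.2) ∧
  ∀ (β : Fin n → ℕ) (α : ℕ), ∃ C : ℝ, ∀ ξ : En n,
    besovE n α (fun x => xiD n β σ x ξ) ≤
      ENNReal.ofReal (C * (1 + ‖ξ‖) ^ (m - ρ * (∑ i, (β i : ℝ)) + δ * α))

/-- The negative Laplacian `(−Δ_ξ) σ` in the `ξ`-variables. -/
def negLapXi (n : ℕ) (σ : En n × En n → ℂ) : En n × En n → ℂ :=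
  fun X => -∑ i : Fin n,
    pdSeq [((0 : En n), unitE n i), ((0 : En n), unitE n i)] σ X

/-! ### Iterated directional derivatives -/

/-- Coordinate direction of `ℝⁿ × ℝⁿ`: `inl i` for `x_i`, `inr j` for the second variable. -/
def bdir (n : ℕ) : Fin n ⊕ Fin n → En n × En n :=
  Sum.elim (fun i => (unitE n i, (0 : En n))) (fun i => ((0 : En n), unitE n i))

section pd
variable {V : Type*} [NormedAddCommGroup V] [NormedSpace ℝ V]

lemma pdSeq_nil (f : V → ℂ) : pdSeq [] f = f := rfl

lemma pdSeq_cons (v : V) (l : List V) (f : V → ℂ) :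
    pdSeq (v :: l) f = fun x => fderiv ℝ (pdSeq l f) x v := rfl

lemma pdSeq_append (l l' : List V) (f : V → ℂ) :
    pdSeq (l ++ l') f = pdSeq l (pdSeq l' f) := by
  simp [pdSeq, List.foldr_append]

lemma contDiff_pd {f : V → ℂ} (hf : ContDiff ℝ (⊤ : ℕ∞) f) (v : V) :
    ContDiff ℝ (⊤ : ℕ∞) (fun x => fderiv ℝ f x v) :=
  (hf.fderiv_right (m := (⊤ : ℕ∞)) (by simp)).clm_apply contDiff_const

lemma contDiff_pdSeq {f : V → ℂ} (hf : ContDiff ℝ (⊤ : ℕ∞) f) (l : List V) :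
    ContDiff ℝ (⊤ : ℕ∞) (pdSeq l f) := by
  induction l with
  | nil => exact hf
  | cons v l ih => exact contDiff_pd ih v

lemma cd_diff {f : V → ℂ} (hf : ContDiff ℝ (⊤ : ℕ∞) f) : Differentiable ℝ f :=
  hf.differentiable (by simp)

lemma pd_swap {f : V → ℂ} (hf : ContDiff ℝ (⊤ : ℕ∞) f) (v w : V) :
    (fun x => fderiv ℝ (fun y => fderiv ℝ f y v) x w) =
      fun x => fderiv ℝ (fun y => fderiv ℝ f y w) x v := by
  have h1 : Differentiable ℝ (fderiv ℝ f) :=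
    (hf.fderiv_right (m := (⊤ : ℕ∞)) (by simp)).differentiable (by simp)
  have key : ∀ (u : V) (x : V), fderiv ℝ (fun y => fderiv ℝ f y u) x =
      (fderiv ℝ (fderiv ℝ f) x).flip u := by
    intro u x
    have := ((h1 x).hasFDerivAt.clm_apply (hasFDerivAt_const u x)).fderiv
    rw [this]; simp
  ext x
  rw [key, key]
  have hs : IsSymmSndFDerivAt ℝ f x := hf.contDiffAt.isSymmSndFDerivAt (by
    simp only [minSmoothness_of_isRCLikeNormedField]
    exact WithTop.coe_le_coe.2 (le_top (a := (2 : ℕ∞))))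
  simpa using hs.eq w v

lemma pdSeq_perm {f : V → ℂ} (hf : ContDiff ℝ (⊤ : ℕ∞) f) {l l' : List V}
    (h : l.Perm l') : pdSeq l f = pdSeq l' f := by
  induction h with
  | nil => rfl
  | cons x _ ih => rw [pdSeq_cons, pdSeq_cons, ih]
  | swap x y l =>
    simp only [pdSeq_cons]
    exact pd_swap (contDiff_pdSeq hf l) _ _
  | trans _ _ ih1 ih2 => rw [ih1, ih2]

lemma pdSeq_add {f g : V → ℂ} (hf : ContDiff ℝ (⊤ : ℕ∞) f) (hg : ContDiff ℝ (⊤ : ℕ∞) g)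
    (l : List V) : pdSeq l (fun x => f x + g x) = fun x => pdSeq l f x + pdSeq l g x := by
  induction l with
  | nil => rfl
  | cons v l ih =>
    rw [pdSeq_cons, ih]
    ext x
    rw [fderiv_fun_add (cd_diff (contDiff_pdSeq hf l) x) (cd_diff (contDiff_pdSeq hg l) x)]
    rfl

lemma pdSeq_neg {f : V → ℂ} (l : List V) :
    pdSeq l (fun x => - f x) = fun x => - pdSeq l f x := by
  induction l with
  | nil => rfl
  | cons v l ih =>
    rw [pdSeq_cons, ih]
    ext x
    rw [fderiv_fun_neg]
    rfl

lemma pdSeq_zero (l : List V) : pdSeq l (fun _ => (0 : ℂ)) = fun _ => 0 := by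
  induction l with
  | nil => rfl
  | cons v l ih => rw [pdSeq_cons, ih]; ext x; simp

lemma pdSeq_congr_open {U : Set V} (hU : IsOpen U) {f g : V → ℂ} (h : Set.EqOn f g U)
    (l : List V) : Set.EqOn (pdSeq l f) (pdSeq l g) U := by
  induction l with
  | nil => exact h
  | cons v l ih =>
    intro x hx
    simp only [pdSeq_cons]
    rw [Filter.EventuallyEq.fderiv_eq (ih.eventuallyEq_of_mem (hU.mem_nhds hx))]

end pd

/-! ### Symbol classes -/

/-- Weight of a coordinate direction. -/
def bw (n : ℕ) (ρ δ : ℝ) : Fin n ⊕ Fin n → ℝ := Sum.elim (fun _ => δ) (fun _ => -ρ)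

/-- Symbol class formulated with arbitrary lists of coordinate directions. -/
def SymC (n : ℕ) (M ρ δ : ℝ) (f : En n × En n → ℂ) : Prop :=
  ContDiff ℝ (⊤ : ℕ∞) f ∧ ∀ l : List (Fin n ⊕ Fin n), ∃ C : ℝ, 0 ≤ C ∧ ∀ x ξ : En n,
    ‖pdSeq (l.map (bdir n)) f (x, ξ)‖ ≤ C * (1 + ‖ξ‖) ^ (M + (l.map (bw n ρ δ)).sum)

lemma dirList_map {V W : Type*} {n : ℕ} (α : Fin n → ℕ) (dir : Fin n → V) (g : V → W) :
    (dirList α dir).map g = dirList α (fun i => g (dir i)) := by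
  simp [dirList, List.map_flatten, List.map_ofFn, Function.comp_def]

lemma count_dirList {V : Type*} [DecidableEq V] {n : ℕ} (α : Fin n → ℕ) (dir : Fin n → V)
    (a : V) : (dirList α dir).count a = ∑ i, if dir i = a then α i else 0 := by
  simp [dirList, List.count_flatten, List.map_ofFn, List.sum_ofFn, List.count_replicate]

lemma sum_dirList {n : ℕ} (α : Fin n → ℕ) (c : ℝ) :
    (dirList α (fun _ => c)).sum = c * ∑ i, (α i : ℝ) := by
  simp [dirList, List.sum_flatten, List.map_ofFn, List.sum_ofFn, Finset.mul_sum, mul_comm]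

lemma perm_canon {n : ℕ} (l : List (Fin n ⊕ Fin n)) :
    ∃ α β : Fin n → ℕ, l.Perm (dirList α Sum.inl ++ dirList β Sum.inr) := by
  let _ : BEq (Fin n ⊕ Fin n) := instBEqOfDecidableEq
  refine ⟨fun i => l.count (Sum.inl i), fun i => l.count (Sum.inr i), ?_⟩
  rw [List.perm_iff_count]
  intro a
  rw [List.count_append, count_dirList, count_dirList]
  rcases a with a | a <;> simp

lemma IsHormander.symC {n : ℕ} {m ρ δ : ℝ} {σ : En n × En n → ℂ}
    (h : IsHormander n m ρ δ σ) : SymC n m ρ δ σ := by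
  refine ⟨h.1, fun l => ?_⟩
  obtain ⟨α, β, hp⟩ := perm_canon l
  obtain ⟨C, hC⟩ := h.2 α β
  refine ⟨max C 0, le_max_right _ _, fun x ξ => ?_⟩
  have h1 := pdSeq_perm h.1 (hp.map (bdir n))
  rw [List.map_append, dirList_map, dirList_map] at h1
  have h2 := (hp.map (bw n ρ δ)).sum_eq
  rw [List.map_append, dirList_map, dirList_map, List.sum_append] at h2
  simp only [bw, Sum.elim_inl, Sum.elim_inr] at h2
  rw [sum_dirList, sum_dirList] at h2
  have h3 := hC x ξ
  unfold mixD at h3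
  simp only [bdir, Sum.elim_inl, Sum.elim_inr] at h1
  have e : m + (l.map (bw n ρ δ)).sum = m - ρ * (∑ i, (β i : ℝ)) +
      δ * (∑ i, (α i : ℝ)) := by
    unfold bw; rw [h2]; ring
  rw [e]
  have h4 : pdSeq (l.map (bdir n)) σ (x, ξ) = _ := congrFun h1 (x, ξ)
  rw [h4]
  refine h3.trans ?_
  gcongr
  exact le_max_left _ _

namespace SymC
variable {n : ℕ} {M ρ δ : ℝ} {f g : En n × En n → ℂ}

lemma add (hf : SymC n M ρ δ f) (hg : SymC n M ρ δ g) :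
    SymC n M ρ δ (fun X => f X + g X) := by
  refine ⟨hf.1.add hg.1, fun l => ?_⟩
  obtain ⟨C, hC0, hC⟩ := hf.2 l
  obtain ⟨D, hD0, hD⟩ := hg.2 l
  refine ⟨C + D, by positivity, fun x ξ => ?_⟩
  rw [pdSeq_add hf.1 hg.1, add_mul]
  exact (norm_add_le _ _).trans (add_le_add (hC x ξ) (hD x ξ))

lemma neg (hf : SymC n M ρ δ f) : SymC n M ρ δ (fun X => - f X) := by
  refine ⟨hf.1.neg, fun l => ?_⟩
  obtain ⟨C, hC0, hC⟩ := hf.2 l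
  refine ⟨C, hC0, fun x ξ => ?_⟩
  rw [pdSeq_neg, norm_neg]
  exact hC x ξ

lemma zero : SymC n M ρ δ (fun _ => 0) := by
  refine ⟨contDiff_const, fun l => ⟨0, le_rfl, fun x ξ => ?_⟩⟩
  simp [pdSeq_zero]

lemma sum {ι : Type*} (s : Finset ι) (F : ι → En n × En n → ℂ)
    (h : ∀ i ∈ s, SymC n M ρ δ (F i)) : SymC n M ρ δ (fun X => ∑ i ∈ s, F i X) := by
  classical
  induction s using Finset.induction_on with
  | empty => simpa using zero
  | insert a s ha ih =>
    simp only [Finset.sum_insert ha]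
    exact (h a (by simp)).add (ih fun i hi => h i (by simp [hi]))

lemma pd (hf : SymC n M ρ δ f) (v : Fin n ⊕ Fin n) :
    SymC n (M + bw n ρ δ v) ρ δ (fun X => fderiv ℝ f X (bdir n v)) := by
  refine ⟨contDiff_pd hf.1 _, fun l => ?_⟩
  obtain ⟨C, hC0, hC⟩ := hf.2 (l ++ [v])
  refine ⟨C, hC0, fun x ξ => ?_⟩
  have := hC x ξ
  rw [List.map_append, pdSeq_append, List.map_append, List.sum_append] at this
  have e : M + bw n ρ δ v + (l.map (bw n ρ δ)).sum =
      M + ((l.map (bw n ρ δ)).sum + (List.map (bw n ρ δ) [v]).sum) := by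
    simp; ring
  rw [e]
  exact this

lemma negLap (hf : SymC n M ρ δ f) : SymC n (M - 2 * ρ) ρ δ (negLapXi n f) := by
  unfold negLapXi
  refine neg (sum _ _ fun i _ => ?_)
  have := (hf.pd (Sum.inr i)).pd (Sum.inr i)
  have e : M - 2 * ρ = M + bw n ρ δ (Sum.inr i) + bw n ρ δ (Sum.inr i) := by
    simp [bw]; ring
  rw [e]
  exact this

lemma iter (hf : SymC n M ρ δ f) (L : ℕ) :
    SymC n (M - 2 * L * ρ) ρ δ ((negLapXi n)^[L] f) := by
  induction L with
  | zero => simpa using hf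
  | succ L ih =>
    rw [Function.iterate_succ_apply']
    convert ih.negLap using 1
    push_cast; ring

lemma bound (hf : SymC n M ρ δ f) : ∃ C : ℝ, 0 ≤ C ∧ ∀ x ξ : En n,
    ‖f (x, ξ)‖ ≤ C * (1 + ‖ξ‖) ^ M := by
  simpa [pdSeq_nil] using hf.2 []

end SymC

/-! ### Functions with decaying derivatives on `{z ≠ 0}` -/

/-- Coordinate functionals dual to `bdir`. -/
def bdual (n : ℕ) : Fin n ⊕ Fin n → (En n × En n →L[ℝ] ℝ) :=
  Sum.elim (fun i => (EuclideanSpace.proj i : En n →L[ℝ] ℝ).comp (ContinuousLinearMap.fst ℝ _ _))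
    (fun i => (EuclideanSpace.proj i : En n →L[ℝ] ℝ).comp (ContinuousLinearMap.snd ℝ _ _))

lemma unitE_apply {n : ℕ} (i j : Fin n) : unitE n i j = if j = i then (1 : ℝ) else 0 := by
  simp [unitE, Pi.single_apply]

lemma inner_unitE {n : ℕ} (z : En n) (i : Fin n) : inner ℝ z (unitE n i) = z i := by
  simp [PiLp.inner_apply, unitE_apply]

lemma bdual_inl {n : ℕ} (i : Fin n) (p : En n × En n) : bdual n (Sum.inl i) p = p.1 i := rfl
lemma bdual_inr {n : ℕ} (i : Fin n) (p : En n × En n) : bdual n (Sum.inr i) p = p.2 i := rfl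

lemma bdual_bdir {n : ℕ} (v w : Fin n ⊕ Fin n) :
    bdual n v (bdir n w) = if v = w then 1 else 0 := by
  rcases v with i | i <;> rcases w with j | j <;>
    simp [bdual_inl, bdual_inr, bdir, unitE]

/-- The linear map with prescribed values on coordinate directions. -/
def comb {n : ℕ} (d : Fin n ⊕ Fin n → ℂ) : En n × En n →L[ℝ] ℂ :=
  ∑ v, (bdual n v).smulRight (d v)

lemma comb_bdir {n : ℕ} (d : Fin n ⊕ Fin n → ℂ) (v : Fin n ⊕ Fin n) :
    comb d (bdir n v) = d v := by
  classical
  unfold comb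
  rw [_root_.sum_apply, Finset.sum_eq_single v]
  · rw [ContinuousLinearMap.smulRight_apply, bdual_bdir]; simp
  · intro b _ hb
    rw [ContinuousLinearMap.smulRight_apply, bdual_bdir]; simp [hb]
  · simp

lemma expand_pt {n : ℕ} (p : En n × En n) : p = ∑ v, bdual n v p • bdir n v := by
  classical
  rw [Fintype.sum_sum_type]
  have key : ∀ z : En n, ∑ i, z i • unitE n i = z := by
    intro z
    ext j
    simp [unitE_apply]
  ext1
  · simp only [bdual_inl, bdual_inr, bdir, Sum.elim_inl, Sum.elim_inr, Prod.smul_mk, smul_zero,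
      Prod.fst_add, Prod.fst_sum, key]
    simp
  · simp only [bdual_inl, bdual_inr, bdir, Sum.elim_inl, Sum.elim_inr, Prod.smul_mk, smul_zero,
      Prod.snd_add, Prod.snd_sum, key]
    simp

lemma clm_ext_bdir {n : ℕ} {S T : En n × En n →L[ℝ] ℂ}
    (h : ∀ v, S (bdir n v) = T (bdir n v)) : S = T := by
  refine ContinuousLinearMap.ext fun p => ?_
  rw [expand_pt p, map_sum, map_sum]
  simp only [map_smul, h]

/-- The region `z ≠ 0`. -/
def UU (n : ℕ) : Set (En n × En n) := {p | p.2 ≠ 0}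

lemma isOpen_UU (n : ℕ) : IsOpen (UU n) := isOpen_ne_fun continuous_snd continuous_const

lemma mem_UU {n : ℕ} {p : En n × En n} (h : (1 / 2 : ℝ) ≤ ‖p.2‖) : p ∈ UU n := by
  intro h0
  rw [h0, norm_zero] at h
  norm_num at h

/-- Size condition. -/
def Bd (n D : ℕ) (u : En n × En n → ℂ) : Prop :=
  ∃ C : ℝ, 0 ≤ C ∧ ∀ p : En n × En n, (1 / 2 : ℝ) ≤ ‖p.2‖ → ‖u p‖ ≤ C * (‖p.2‖ ^ D)⁻¹

/-- `u` is `r` times differentiable on `z ≠ 0`, all derivatives up to order `r` being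
`O(|z|^{-D})` on `|z| ≥ 1/2`. -/
def GG (n D : ℕ) : ℕ → (En n × En n → ℂ) → Prop
  | 0, u => Bd n D u
  | r + 1, u => Bd n D u ∧ ∃ du : Fin n ⊕ Fin n → En n × En n → ℂ, (∀ v, GG n D r (du v)) ∧
      ∀ p ∈ UU n, HasFDerivAt u (comb fun v => du v p) p

namespace Bd
variable {n D E : ℕ} {u w : En n × En n → ℂ}

lemma add (hu : Bd n D u) (hw : Bd n D w) : Bd n D (fun p => u p + w p) := by
  obtain ⟨C, hC0, hC⟩ := hu
  obtain ⟨C', hC0', hC'⟩ := hw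
  refine ⟨C + C', by positivity, fun p hp => ?_⟩
  rw [add_mul]
  exact (norm_add_le _ _).trans (add_le_add (hC p hp) (hC' p hp))

lemma mul (hu : Bd n D u) (hw : Bd n E w) : Bd n (D + E) (fun p => u p * w p) := by
  obtain ⟨C, hC0, hC⟩ := hu
  obtain ⟨C', hC0', hC'⟩ := hw
  refine ⟨C * C', by positivity, fun p hp => ?_⟩
  rw [norm_mul, pow_add, mul_inv, mul_mul_mul_comm]
  exact mul_le_mul (hC p hp) (hC' p hp) (norm_nonneg _) (by positivity)

lemma weaken (hu : Bd n (D + 1) u) : Bd n D u := by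
  obtain ⟨C, hC0, hC⟩ := hu
  refine ⟨C * 2, by positivity, fun p hp => (hC p hp).trans ?_⟩
  have h0 : 0 < ‖p.2‖ := by linarith
  rw [pow_succ, mul_inv, mul_assoc, mul_comm (2 : ℝ)]
  gcongr
  rw [inv_le_comm₀ h0 (by norm_num)]
  linarith

lemma congr (hu : Bd n D u) (h : Set.EqOn u w (UU n)) : Bd n D w := by
  obtain ⟨C, hC0, hC⟩ := hu
  refine ⟨C, hC0, fun p hp => ?_⟩
  rw [← h (mem_UU hp)]
  exact hC p hp

end Bd

namespace GG
variable {n D E r : ℕ} {u w : En n × En n → ℂ}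

lemma bd (hu : GG n D r u) : Bd n D u := by
  cases r with
  | zero => exact hu
  | succ r => exact hu.1

lemma pred (hu : GG n D (r + 1) u) : GG n D r u := by
  induction r generalizing u with
  | zero => exact hu.1
  | succ r ih =>
    obtain ⟨h1, du, h2, h3⟩ := hu
    exact ⟨h1, du, fun v => ih (h2 v), h3⟩

lemma congr (hu : GG n D r u) (h : Set.EqOn u w (UU n)) : GG n D r w := by
  cases r with
  | zero => exact Bd.congr hu h
  | succ r =>
    obtain ⟨h1, du, h2, h3⟩ := hu
    refine ⟨h1.congr h, du, h2, fun p hp => (h3 p hp).congr_of_eventuallyEq ?_⟩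
    exact (h.eventuallyEq_of_mem ((isOpen_UU n).mem_nhds hp)).symm

lemma weaken (hu : GG n (D + 1) r u) : GG n D r u := by
  induction r generalizing u with
  | zero => exact Bd.weaken hu
  | succ r ih =>
    obtain ⟨h1, du, h2, h3⟩ := hu
    exact ⟨h1.weaken, du, fun v => ih (h2 v), h3⟩

lemma add (hu : GG n D r u) (hw : GG n D r w) : GG n D r (fun p => u p + w p) := by
  induction r generalizing u w with
  | zero => exact Bd.add hu hw
  | succ r ih =>
    obtain ⟨h1, du, h2, h3⟩ := hu
    obtain ⟨k1, dw, k2, k3⟩ := hw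
    refine ⟨h1.add k1, fun v p => du v p + dw v p, fun v => ih (h2 v) (k2 v), fun p hp => ?_⟩
    refine ((h3 p hp).add (k3 p hp)).congr_fderiv ?_
    apply clm_ext_bdir
    intro v
    simp [comb_bdir]

lemma mul (hu : GG n D r u) (hw : GG n E r w) : GG n (D + E) r (fun p => u p * w p) := by
  induction r generalizing u w with
  | zero => exact Bd.mul hu hw
  | succ r ih =>
    have hu' := hu.pred
    have hw' := hw.pred
    obtain ⟨h1, du, h2, h3⟩ := hu
    obtain ⟨k1, dw, k2, k3⟩ := hw
    refine ⟨h1.mul k1, fun v p => u p * dw v p + du v p * w p,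
      fun v => (ih hu' (k2 v)).add (ih (h2 v) hw'), fun p hp => ?_⟩
    refine ((h3 p hp).mul (k3 p hp)).congr_fderiv ?_
    apply clm_ext_bdir
    intro v
    simp [comb_bdir]
    try ring

lemma zero : GG n D r (fun _ => 0) := by
  induction r with
  | zero => exact ⟨0, le_rfl, by simp⟩
  | succ r ih =>
    refine ⟨⟨0, le_rfl, by simp⟩, fun _ _ => 0, fun _ => ih, fun p _ => ?_⟩
    convert hasFDerivAt_const (0 : ℂ) p using 1
    apply clm_ext_bdir
    intro v
    simp [comb_bdir]

lemma const (c : ℂ) : GG n 0 r (fun _ => c) := by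
  cases r with
  | zero => exact ⟨‖c‖, norm_nonneg _, by simp⟩
  | succ r =>
    refine ⟨⟨‖c‖, norm_nonneg _, by simp⟩, fun _ _ => 0, fun _ => zero, fun p _ => ?_⟩
    convert hasFDerivAt_const (c : ℂ) p using 1
    apply clm_ext_bdir
    intro v
    simp [comb_bdir]

lemma const_mul (hu : GG n D r u) (c : ℂ) : GG n D r (fun p => c * u p) := by
  simpa using (const (n := n) (r := r) c).mul hu

lemma sum {ι : Type*} (s : Finset ι) (F : ι → En n × En n → ℂ)
    (h : ∀ i ∈ s, GG n D r (F i)) : GG n D r (fun X => ∑ i ∈ s, F i X) := by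
  classical
  induction s using Finset.induction_on with
  | empty => simpa using zero
  | insert a s ha ih =>
    simp only [Finset.sum_insert ha]
    exact (h a (by simp)).add (ih fun i hi => h i (by simp [hi]))

lemma pow (hu : GG n D r u) (k : ℕ) : GG n (D * k) r (fun p => u p ^ k) := by
  induction k with
  | zero => simpa using const 1
  | succ k ih =>
    simp only [pow_succ, mul_add, mul_one]
    exact ih.mul hu

lemma contDiffOn (hu : GG n D (r + 1) u) : ContDiffOn ℝ r u (UU n) := by
  induction r generalizing u with
  | zero =>
    obtain ⟨h1, du, h2, h3⟩ := hu
    simp only [Nat.cast_zero, contDiffOn_zero]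
    exact fun p hp => (h3 p hp).continuousAt.continuousWithinAt
  | succ r ih =>
    obtain ⟨h1, du, h2, h3⟩ := hu
    push_cast
    rw [contDiffOn_succ_iff_hasFDerivWithinAt_of_uniqueDiffOn (isOpen_UU n).uniqueDiffOn]
    refine ⟨by simp, fun p => comb fun v => du v p, ?_, fun p hp => (h3 p hp).hasFDerivWithinAt⟩
    unfold comb
    refine ContDiffOn.sum fun v _ => ?_
    exact (ContinuousLinearMap.smulRightL ℝ (En n × En n) ℂ (bdual n v)).contDiff.comp_contDiffOn
      (ih (h2 v))

lemma pdSeq_bd (l : List (Fin n ⊕ Fin n)) : ∀ {r : ℕ} {u : En n × En n → ℂ},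
    GG n D r u → l.length ≤ r → Bd n D (pdSeq (l.map (bdir n)) u) := by
  induction l using List.reverseRecOn with
  | nil => intro r u hu _; exact hu.bd
  | append_singleton l v ih =>
    intro r u hu hl
    rw [List.length_append, List.length_singleton] at hl
    obtain ⟨r, rfl⟩ : ∃ s, r = s + 1 := ⟨r - 1, by omega⟩
    obtain ⟨h1, du, h2, h3⟩ := hu
    rw [List.map_append, pdSeq_append]
    refine (ih (h2 v) (by omega)).congr (pdSeq_congr_open (isOpen_UU n) ?_ _)
    intro p hp
    simp only [List.map_cons, List.map_nil, pdSeq_cons, pdSeq_nil]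
    rw [(h3 p hp).fderiv, comb_bdir]

end GG

/-- The coordinates `z_j / |z|²`. -/
def wco (n : ℕ) (j : Fin n) (p : En n × En n) : ℂ := ((p.2 j * (‖p.2‖ ^ 2)⁻¹ : ℝ) : ℂ)

lemma sum_wco {n : ℕ} {p : En n × En n} (hp : p ∈ UU n) :
    ∑ k, wco n k p * wco n k p = (((‖p.2‖ ^ 2)⁻¹ : ℝ) : ℂ) := by
  have h0 : ‖p.2‖ ≠ 0 := norm_ne_zero_iff.2 hp
  unfold wco
  rw [← Complex.ofReal_inj.2 (show (∑ k, (p.2 k * (‖p.2‖ ^ 2)⁻¹) * (p.2 k * (‖p.2‖ ^ 2)⁻¹)) =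
    (‖p.2‖ ^ 2)⁻¹ from ?_)]
  · push_cast; rfl
  · have : ∑ k, (p.2 k * (‖p.2‖ ^ 2)⁻¹) * (p.2 k * (‖p.2‖ ^ 2)⁻¹) =
        (∑ k, p.2 k ^ 2) * ((‖p.2‖ ^ 2)⁻¹) ^ 2 := by
      rw [Finset.sum_mul]
      exact Finset.sum_congr rfl fun k _ => by ring
    rw [this, ← EuclideanSpace.real_norm_sq_eq]
    field_simp

lemma hasFDerivAt_wco {n : ℕ} (j : Fin n) {p : En n × En n} (hp : p ∈ UU n) :
    HasFDerivAt (wco n j) (comb fun v => Sum.elim (fun _ => 0)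
      (fun i => (if i = j then (1 : ℂ) else 0) * (∑ k, wco n k p * wco n k p) +
        (-2) * (wco n i p * wco n j p)) v) p := by
  have h0 : ‖p.2‖ ≠ 0 := norm_ne_zero_iff.2 hp
  have hA : HasFDerivAt (fun q : En n × En n => q.2 j) (bdual n (Sum.inr j)) p :=
    (bdual n (Sum.inr j)).hasFDerivAt
  have hB : HasFDerivAt (fun q : En n × En n => ‖q.2‖ ^ 2)
      ((2 • (innerSL ℝ p.2)).comp (ContinuousLinearMap.snd ℝ _ _)) p :=
    (hasStrictFDerivAt_norm_sq p.2).hasFDerivAt.comp p hasFDerivAt_snd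
  have hC := (hasDerivAt_inv (pow_ne_zero 2 h0)).comp_hasFDerivAt p hB
  have hD := Complex.ofRealCLM.hasFDerivAt.comp p (hA.mul hC)
  refine HasFDerivAt.congr_fderiv (f' := _) hD ?_
  apply clm_ext_bdir
  intro v
  rw [comb_bdir]
  rw [sum_wco hp]
  rcases v with i | i
  · simp [bdual_inr, unitE_apply, bdir]
  · have e := inner_unitE p.2 i
    by_cases hij : j = i
    · subst hij
      simp [bdual_inr, unitE_apply, bdir, wco, e]
      field_simp
      ring
    · simp [bdual_inr, unitE_apply, bdir, wco, e, hij, Ne.symm hij]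
      field_simp

lemma bd_wco {n : ℕ} (j : Fin n) : Bd n 1 (wco n j) := by
  refine ⟨1, zero_le_one, fun p hp => ?_⟩
  have h0 : 0 < ‖p.2‖ := by linarith
  unfold wco
  rw [Complex.norm_real, norm_mul, norm_inv, norm_pow, norm_norm, pow_one, one_mul]
  calc ‖p.2 j‖ * (‖p.2‖ ^ 2)⁻¹ ≤ ‖p.2‖ * (‖p.2‖ ^ 2)⁻¹ := by
        gcongr
        exact PiLp.norm_apply_le p.2 j
    _ = ‖p.2‖⁻¹ := by field_simp

lemma gg_wco {n : ℕ} (r : ℕ) : ∀ j : Fin n, GG n 1 r (wco n j) := by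
  induction r with
  | zero => exact fun j => bd_wco j
  | succ r ih =>
    intro j
    refine ⟨bd_wco j, fun v p => _, fun v => ?_, fun p hp => hasFDerivAt_wco j hp⟩
    rcases v with i | i
    · exact GG.zero
    · refine GG.weaken ?_
      exact (GG.const_mul (GG.sum _ _ fun k _ => (ih k).mul (ih k)) _).add
        (((ih i).mul (ih j)).const_mul _)

lemma gg_normpow {n : ℕ} (r L : ℕ) :
    GG n (2 * L) r (fun p => (((‖p.2‖ ^ (2 * L))⁻¹ : ℝ) : ℂ)) := by
  have h : GG n 2 r (fun p => ∑ k, wco n k p * wco n k p) :=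
    GG.sum _ _ fun k _ => (gg_wco r k).mul (gg_wco r k)
  refine (h.pow L).congr fun p hp => ?_
  simp only
  rw [sum_wco hp, pow_mul]
  push_cast
  rw [inv_pow]

/-! ### Oscillatory integrals -/

/-- Amplitudes: only derivatives in the first variable are controlled. -/
def AC (n : ℕ) (M δ : ℝ) (g : En n × En n → ℂ) : Prop :=
  ContDiff ℝ (⊤ : ℕ∞) g ∧ ∀ l : List (Fin n), ∃ C : ℝ, 0 ≤ C ∧ ∀ x ξ : En n,
    ‖pdSeq (l.map fun i => bdir n (Sum.inl i)) g (x, ξ)‖ ≤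
      C * (1 + ‖ξ‖) ^ (M + δ * (l.length : ℝ))

lemma SymC.ac {n : ℕ} {M ρ δ : ℝ} {f : En n × En n → ℂ} (h : SymC n M ρ δ f) :
    AC n M δ f := by
  refine ⟨h.1, fun l => ?_⟩
  obtain ⟨C, hC0, hC⟩ := h.2 (l.map Sum.inl)
  refine ⟨C, hC0, fun x ξ => ?_⟩
  have := hC x ξ
  rw [List.map_map, List.map_map] at this
  have e : (l.map (bw n ρ δ ∘ Sum.inl)).sum = δ * (l.length : ℝ) := by
    have : (bw n ρ δ ∘ Sum.inl : Fin n → ℝ) = fun _ => δ := rfl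
    rw [this]
    simp [mul_comm]
  rw [e] at this
  exact this

namespace AC
variable {n : ℕ} {M M' δ : ℝ} {g : En n × En n → ℂ}

lemma mono (h : AC n M δ g) (hM : M ≤ M') : AC n M' δ g := by
  refine ⟨h.1, fun l => ?_⟩
  obtain ⟨C, hC0, hC⟩ := h.2 l
  refine ⟨C, hC0, fun x ξ => (hC x ξ).trans ?_⟩
  gcongr
  linarith [norm_nonneg ξ]

lemma pdx (h : AC n M δ g) (i : Fin n) :
    AC n (M + δ) δ (fun X => fderiv ℝ g X (bdir n (Sum.inl i))) := by
  refine ⟨contDiff_pd h.1 _, fun l => ?_⟩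
  obtain ⟨C, hC0, hC⟩ := h.2 (l ++ [i])
  refine ⟨C, hC0, fun x ξ => ?_⟩
  have := hC x ξ
  rw [List.map_append, pdSeq_append] at this
  have e : M + δ + δ * (l.length : ℝ) = M + δ * ((l ++ [i]).length : ℝ) := by
    simp; ring
  rw [e]
  exact this

lemma cd_coord (j : Fin n) :
    ContDiff ℝ (⊤ : ℕ∞) (fun X : En n × En n => Complex.I * ((X.2 j : ℝ) : ℂ)) :=
  contDiff_const.mul
    ((Complex.ofRealCLM.contDiff).comp (bdual n (Sum.inr j)).contDiff)

lemma pdSeq_mulxi (hg : ContDiff ℝ (⊤ : ℕ∞) g) (j : Fin n) (l : List (Fin n)) :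
    pdSeq (l.map fun i => bdir n (Sum.inl i)) (fun X => Complex.I * ((X.2 j : ℝ) : ℂ) * g X) =
      fun X => Complex.I * ((X.2 j : ℝ) : ℂ) *
        pdSeq (l.map fun i => bdir n (Sum.inl i)) g X := by
  induction l with
  | nil => rfl
  | cons i l ih =>
    rw [List.map_cons, pdSeq_cons, ih, pdSeq_cons]
    ext X
    have hd : HasFDerivAt (fun X : En n × En n => Complex.I * ((X.2 j : ℝ) : ℂ))
        (Complex.I • (Complex.ofRealCLM.comp (bdual n (Sum.inr j)))) X :=
      ((Complex.ofRealCLM.comp (bdual n (Sum.inr j))).hasFDerivAt).const_mul Complex.I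
    have := (hd.mul (cd_diff (contDiff_pdSeq hg (l.map fun i => bdir n (Sum.inl i))) X).hasFDerivAt)
    rw [show (fun x : En n × En n => Complex.I * ((x.2 j : ℝ) : ℂ) *
      pdSeq (l.map fun i => bdir n (Sum.inl i)) g x) =
      (fun X : En n × En n => Complex.I * ((X.2 j : ℝ) : ℂ)) *
        pdSeq (l.map fun i => bdir n (Sum.inl i)) g from rfl, this.fderiv]
    simp [bdual_bdir]

lemma mulxi (h : AC n M δ g) (j : Fin n) :
    AC n (M + 1) δ (fun X => Complex.I * ((X.2 j : ℝ) : ℂ) * g X) := by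
  refine ⟨(cd_coord j).mul h.1, fun l => ?_⟩
  obtain ⟨C, hC0, hC⟩ := h.2 l
  refine ⟨C, hC0, fun x ξ => ?_⟩
  rw [pdSeq_mulxi h.1]
  simp only [norm_mul, Complex.norm_I, one_mul, Complex.norm_real]
  have h1 : ‖ξ j‖ ≤ 1 + ‖ξ‖ := (PiLp.norm_apply_le ξ j).trans (by linarith)
  have h0 : 0 < 1 + ‖ξ‖ := by positivity
  calc _ ≤ (1 + ‖ξ‖) * (C * (1 + ‖ξ‖) ^ (M + δ * (l.length : ℝ))) :=
        mul_le_mul h1 (hC x ξ) (norm_nonneg _) h0.le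
    _ = C * (1 + ‖ξ‖) ^ (M + 1 + δ * (l.length : ℝ)) := by
        rw [show M + 1 + δ * (l.length : ℝ) = (M + δ * (l.length : ℝ)) + 1 by ring,
          Real.rpow_add_one h0.ne']
        ring

lemma bound (h : AC n M δ g) : ∃ C : ℝ, 0 ≤ C ∧ ∀ x ξ : En n,
    ‖g (x, ξ)‖ ≤ C * (1 + ‖ξ‖) ^ M := by
  simpa [pdSeq_nil] using h.2 []

end AC

/-- The phase. -/
def ph {n : ℕ} (z ξ : En n) : ℂ := Complex.exp (Complex.I * ((⟪z, ξ⟫ : ℝ) : ℂ))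

lemma norm_ph {n : ℕ} (z ξ : En n) : ‖ph z ξ‖ = 1 := by
  unfold ph
  rw [mul_comm]
  exact Complex.norm_exp_ofReal_mul_I _

lemma cont_ph {n : ℕ} (z : En n) : Continuous (fun ξ => ph z ξ) := by
  unfold ph
  fun_prop

/-- The oscillatory integral with amplitude `g`. -/
def OI {n : ℕ} (g : En n × En n → ℂ) (p : En n × En n) : ℂ :=
  ∫ ξ : En n, ph p.2 ξ * g (p.1, ξ)

lemma int_bracket {n : ℕ} {M : ℝ} (hM : M < -(n : ℝ)) :
    Integrable (fun ξ : En n => (1 + ‖ξ‖) ^ M) := by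
  have := integrable_one_add_norm (E := En n) (μ := volume) (r := -M) (by
    simp; linarith)
  simpa using this

namespace AC
variable {n : ℕ} {M M' δ : ℝ} {g : En n × En n → ℂ}

lemma cont_slice (h : AC n M δ g) (x : En n) : Continuous fun ξ => g (x, ξ) :=
  h.1.continuous.comp (by fun_prop)

lemma integrable_slice (h : AC n M δ g) (hM : M < -(n : ℝ)) (x : En n) :
    Integrable fun ξ : En n => g (x, ξ) := by
  obtain ⟨C, hC0, hC⟩ := h.bound
  exact ((int_bracket hM).const_mul C).mono' (h.cont_slice x).aestronglyMeasurable
    (Filter.Eventually.of_forall fun ξ => hC x ξ)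

lemma integrable (h : AC n M δ g) (hM : M < -(n : ℝ)) (p : En n × En n) :
    Integrable fun ξ : En n => ph p.2 ξ * g (p.1, ξ) := by
  obtain ⟨C, hC0, hC⟩ := h.bound
  refine ((int_bracket hM).const_mul C).mono'
    ((cont_ph p.2).mul (h.cont_slice p.1)).aestronglyMeasurable
    (Filter.Eventually.of_forall fun ξ => ?_)
  rw [norm_mul, norm_ph, one_mul]
  exact hC _ _

lemma bd_OI (h : AC n M δ g) (hM : M < -(n : ℝ)) : Bd n 0 (OI g) := by
  obtain ⟨C, hC0, hC⟩ := h.bound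
  refine ⟨∫ ξ : En n, C * (1 + ‖ξ‖) ^ M, integral_nonneg fun ξ => by positivity,
    fun p _ => ?_⟩
  rw [pow_zero, inv_one, mul_one]
  refine norm_integral_le_of_norm_le ((int_bracket hM).const_mul C)
    (Filter.Eventually.of_forall fun ξ => ?_)
  rw [norm_mul, norm_ph, one_mul]
  exact hC _ _

/-- Amplitudes of the derivatives. -/
def dAmp (g : En n × En n → ℂ) : Fin n ⊕ Fin n → En n × En n → ℂ :=
  Sum.elim (fun i X => fderiv ℝ g X (bdir n (Sum.inl i)))
    (fun j X => Complex.I * ((X.2 j : ℝ) : ℂ) * g X)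

lemma dAmp_ac (h : AC n M δ g) (hδ : 0 ≤ δ) (v : Fin n ⊕ Fin n) :
    AC n (M + (1 + δ)) δ (dAmp g v) := by
  rcases v with i | i
  · exact (h.pdx i).mono (by linarith)
  · exact (h.mulxi i).mono (by linarith)

lemma hasFDerivAt_integrand (h : AC n M δ g) (p : En n × En n) (ξ : En n) :
    HasFDerivAt (fun p : En n × En n => ph p.2 ξ * g (p.1, ξ))
      (comb fun v => ph p.2 ξ * dAmp g v (p.1, ξ)) p := by
  have h1 : HasFDerivAt (fun p : En n × En n => (⟪p.2, ξ⟫ : ℝ))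
      ((innerSL ℝ ξ).comp (ContinuousLinearMap.snd ℝ (En n) (En n))) p := by
    have := ((innerSL ℝ ξ).comp (ContinuousLinearMap.snd ℝ (En n) (En n))).hasFDerivAt (x := p)
    refine this.congr_of_eventuallyEq (Filter.Eventually.of_forall fun q => ?_)
    simp [real_inner_comm]
  have h2 := ((Complex.ofRealCLM.hasFDerivAt.comp p h1).const_mul Complex.I).cexp
  have h3 : HasFDerivAt (fun p : En n × En n => g (p.1, ξ))
      ((fderiv ℝ g (p.1, ξ)).comp ((ContinuousLinearMap.fst ℝ (En n) (En n)).prod 0)) p :=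
    HasFDerivAt.comp (f := fun p : En n × En n => (p.1, ξ)) p
      (cd_diff h.1 (p.1, ξ)).hasFDerivAt (hasFDerivAt_fst.prodMk (hasFDerivAt_const ξ p))
  refine HasFDerivAt.congr_fderiv (h2.mul h3) ?_
  apply clm_ext_bdir
  intro v
  rw [comb_bdir]
  rcases v with i | i
  · simp [dAmp, bdir, ph]
  · have e := inner_unitE ξ i
    have e0 : fderiv ℝ g (p.1, ξ) ((0 : En n), (0 : En n)) = 0 := map_zero _
    simp [dAmp, bdir, ph, e, e0]
    ring

lemma hasFDerivAt_OI (h : AC n M δ g) (hδ : 0 ≤ δ) (hM : M + (1 + δ) < -(n : ℝ))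
    (p : En n × En n) : HasFDerivAt (OI g) (comb fun v => OI (dAmp g v) p) p := by
  have hM' : M < -(n : ℝ) := by linarith
  choose C hC0 hC using fun v => (h.dAmp_ac hδ v).bound
  have key := hasFDerivAt_integral_of_dominated_of_fderiv_le (𝕜 := ℝ) (μ := volume)
    (F := fun (p : En n × En n) (ξ : En n) => ph p.2 ξ * g (p.1, ξ)) (s := Set.univ) (x₀ := p)
    (F' := fun p ξ => comb fun v => ph p.2 ξ * dAmp g v (p.1, ξ))
    (bound := fun ξ => ∑ v, ‖bdual n v‖ * (C v * (1 + ‖ξ‖) ^ (M + (1 + δ))))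
    Filter.univ_mem
    (Filter.Eventually.of_forall fun q => (h.integrable hM' q).aestronglyMeasurable)
    (h.integrable hM' p) ?_ ?_ ?_ ?_
  · refine key.congr_fderiv ?_
    unfold comb
    rw [integral_finsetSum]
    · refine Finset.sum_congr rfl fun v _ => ?_
      exact ((ContinuousLinearMap.smulRightL ℝ (En n × En n) ℂ (bdual n v))).integral_comp_comm
        ((h.dAmp_ac hδ v).integrable hM p)
    · intro v _
      exact ((ContinuousLinearMap.smulRightL ℝ (En n × En n) ℂ (bdual n v))).integrable_comp
        ((h.dAmp_ac hδ v).integrable hM p)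
  · refine Continuous.aestronglyMeasurable ?_
    unfold comb
    refine continuous_finsetSum _ fun v _ => ?_
    exact ((ContinuousLinearMap.smulRightL ℝ (En n × En n) ℂ (bdual n v))).continuous.comp
      ((cont_ph p.2).mul ((h.dAmp_ac hδ v).cont_slice p.1))
  · refine Filter.Eventually.of_forall fun ξ q _ => ?_
    unfold comb
    refine (norm_sum_le _ _).trans (Finset.sum_le_sum fun v _ => ?_)
    rw [ContinuousLinearMap.norm_smulRight_apply, norm_mul, norm_ph, one_mul]
    gcongr
    exact hC v _ _
  · exact integrable_finsetSum _ fun v _ => ((int_bracket hM).const_mul _).const_mul _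
  · exact Filter.Eventually.of_forall fun ξ q _ => h.hasFDerivAt_integrand q ξ

lemma gg_OI (hδ : 0 ≤ δ) (r : ℕ) : ∀ {M : ℝ} {g : En n × En n → ℂ}, AC n M δ g →
    M + r * (1 + δ) < -(n : ℝ) → GG n 0 r (OI g) := by
  induction r with
  | zero =>
    intro M g h hM
    exact h.bd_OI (by simpa using hM)
  | succ r ih =>
    intro M g h hM
    push_cast at hM
    have h0 : 0 ≤ (r : ℝ) * (1 + δ) := by positivity
    refine ⟨h.bd_OI (by nlinarith), fun v => OI (dAmp g v),
      fun v => ih (h.dAmp_ac hδ v) (by nlinarith),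
      fun p _ => h.hasFDerivAt_OI hδ (by nlinarith) p⟩

end AC

/-! ### Integration by parts -/

lemma OI_pd {n : ℕ} {M ρ δ : ℝ} {f : En n × En n → ℂ} (hf : SymC n M ρ δ f) (hρ : 0 < ρ)
    (hM : M < -(n : ℝ)) (i : Fin n) (p : En n × En n) :
    OI (fun X => fderiv ℝ f X (bdir n (Sum.inr i))) p =
      -(Complex.I * ((p.2 i : ℝ) : ℂ)) * OI f p := by
  have hpd := hf.pd (Sum.inr i)
  have hd : ∀ ξ, HasFDerivAt (fun ξ => f (p.1, ξ))
      ((fderiv ℝ f (p.1, ξ)).comp (ContinuousLinearMap.inr ℝ (En n) (En n))) ξ := fun ξ =>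
    HasFDerivAt.comp (f := fun ξ : En n => (p.1, ξ)) ξ
      (cd_diff hf.1 (p.1, ξ)).hasFDerivAt (hasFDerivAt_prodMk_right p.1 ξ)
  have hd' : ∀ ξ, fderiv ℝ (fun ξ => f (p.1, ξ)) ξ (unitE n i) =
      fderiv ℝ f (p.1, ξ) (bdir n (Sum.inr i)) := by
    intro ξ
    rw [(hd ξ).fderiv]
    simp [bdir]
  have hp : ∀ ξ, HasFDerivAt (fun ξ => ph p.2 ξ)
      (ph p.2 ξ • (Complex.I • (Complex.ofRealCLM.comp (innerSL ℝ p.2)))) ξ := fun ξ =>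
    ((Complex.ofRealCLM.hasFDerivAt.comp ξ (innerSL ℝ p.2).hasFDerivAt).const_mul Complex.I).cexp
  have hp' : ∀ ξ, fderiv ℝ (fun ξ => ph p.2 ξ) ξ (unitE n i) =
      Complex.I * ((p.2 i : ℝ) : ℂ) * ph p.2 ξ := by
    intro ξ
    rw [(hp ξ).fderiv]
    have e := inner_unitE p.2 i
    simp [e]
    ring
  have hI := hf.ac.integrable hM p
  have hI' := hpd.ac.integrable (by simp [bw]; linarith) p
  have := integral_mul_fderiv_eq_neg_fderiv_mul_of_integrable (𝕜 := ℂ) (μ := volume)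
    (f := fun ξ => ph p.2 ξ) (g := fun ξ => f (p.1, ξ)) (v := unitE n i)
    (by
      simp only [hp', mul_assoc]
      simpa only [mul_assoc] using hI.const_mul (Complex.I * ((p.2 i : ℝ) : ℂ)))
    (by simpa only [hd'] using hI') hI
    (fun ξ _ => (hp ξ).differentiableAt) (fun ξ _ => (hd ξ).differentiableAt)
  simp only [hd', hp', mul_assoc] at this
  unfold OI
  rw [this, integral_const_mul, integral_const_mul]
  ring

lemma OI_negLap {n : ℕ} {M ρ δ : ℝ} {f : En n × En n → ℂ} (hf : SymC n M ρ δ f) (hρ : 0 < ρ)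
    (hM : M < -(n : ℝ)) (p : En n × En n) :
    OI (negLapXi n f) p = ((‖p.2‖ ^ 2 : ℝ) : ℂ) * OI f p := by
  have h2 : ∀ i : Fin n, OI (pdSeq [((0 : En n), unitE n i), ((0 : En n), unitE n i)] f) p =
      -(((p.2 i) ^ 2 : ℝ) : ℂ) * OI f p := by
    intro i
    have a := OI_pd (hf.pd (Sum.inr i)) hρ (by simp [bw]; linarith) i p
    rw [OI_pd hf hρ hM i p] at a
    refine Eq.trans a ?_
    push_cast
    linear_combination ((p.2 i : ℝ) : ℂ) ^ 2 * OI f p * Complex.I_sq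
  have h3 : OI (negLapXi n f) p =
      -∑ i : Fin n, OI (pdSeq [((0 : En n), unitE n i), ((0 : En n), unitE n i)] f) p := by
    unfold OI negLapXi
    rw [← integral_finsetSum, ← integral_neg]
    · congr 1
      ext ξ
      rw [mul_neg, Finset.mul_sum]
    · intro i _
      exact ((hf.pd (Sum.inr i)).pd (Sum.inr i)).ac.integrable (by simp [bw]; linarith) p
  rw [h3, EuclideanSpace.real_norm_sq_eq]
  simp only [h2]
  push_cast
  rw [Finset.sum_mul, ← Finset.sum_neg_distrib]
  exact Finset.sum_congr rfl fun i _ => by ring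

/-- The kernel formula with parameter `L`. -/
def kL (n : ℕ) (σ : En n × En n → ℂ) (L : ℕ) (p : En n × En n) : ℂ :=
  ((((2 * Real.pi) ^ n)⁻¹ : ℝ) : ℂ) * (((‖p.2‖ ^ (2 * L))⁻¹ : ℝ) : ℂ) *
    OI ((negLapXi n)^[L] σ) p

lemma kL_succ {n : ℕ} {m ρ δ : ℝ} {σ : En n × En n → ℂ} (hσ : SymC n m ρ δ σ) (hρ : 0 < ρ)
    {L : ℕ} (hL : m - 2 * L * ρ < -(n : ℝ)) {p : En n × En n} (hp : p ∈ UU n) :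
    kL n σ (L + 1) p = kL n σ L p := by
  have h0 : ((‖p.2‖ : ℝ) : ℂ) ≠ 0 := by exact_mod_cast norm_ne_zero_iff.2 hp
  unfold kL
  rw [Function.iterate_succ_apply', OI_negLap (hσ.iter L) hρ hL]
  push_cast
  rw [mul_add, pow_add]
  field_simp

lemma kL_add {n : ℕ} {m ρ δ : ℝ} {σ : En n × En n → ℂ} (hσ : SymC n m ρ δ σ) (hρ : 0 < ρ)
    {L : ℕ} (hL : m - 2 * L * ρ < -(n : ℝ)) {p : En n × En n} (hp : p ∈ UU n) (d : ℕ) :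
    kL n σ (L + d) p = kL n σ L p := by
  induction d with
  | zero => rfl
  | succ d ih =>
    rw [← add_assoc, kL_succ hσ hρ _ hp, ih]
    push_cast
    have : 0 ≤ (d : ℝ) * ρ := by positivity
    nlinarith

lemma kL_eq {n : ℕ} {m ρ δ : ℝ} {σ : En n × En n → ℂ} (hσ : SymC n m ρ δ σ) (hρ : 0 < ρ)
    {L L' : ℕ} (hL : m - 2 * L * ρ < -(n : ℝ)) (hL' : m - 2 * L' * ρ < -(n : ℝ))
    {p : En n × En n} (hp : p ∈ UU n) : kL n σ L p = kL n σ L' p := by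
  rcases le_total L L' with h | h
  · obtain ⟨d, rfl⟩ := Nat.exists_eq_add_of_le h
    exact (kL_add hσ hρ hL hp d).symm
  · obtain ⟨d, rfl⟩ := Nat.exists_eq_add_of_le h
    exact kL_add hσ hρ hL' hp d

lemma exists_L {n : ℕ} (m : ℝ) {ρ : ℝ} (hρ : 0 < ρ) (c : ℝ) :
    ∃ L0 : ℕ, ∀ L : ℕ, L0 ≤ L → m - 2 * L * ρ + c < -(n : ℝ) := by
  obtain ⟨L0, h0⟩ := exists_nat_gt ((m + c + n) / (2 * ρ))
  refine ⟨L0, fun L hL => ?_⟩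
  have h1 : (L0 : ℝ) ≤ L := by exact_mod_cast hL
  have h2 := h0.trans_le h1
  rw [div_lt_iff₀ (by positivity)] at h2
  linarith

lemma gg_kL {n : ℕ} {m ρ δ : ℝ} {σ : En n × En n → ℂ} (hσ : SymC n m ρ δ σ) (hδ : 0 ≤ δ)
    {L r : ℕ} (hL : m - 2 * L * ρ + r * (1 + δ) < -(n : ℝ)) :
    GG n (2 * L) r (kL n σ L) := by
  have h := AC.gg_OI hδ r (hσ.iter L).ac hL
  exact ((gg_normpow r L).const_mul _).mul h

/-- Let `σ ∈ S^m_{ρ,δ}` with `ρ > 0`.  For every `L ∈ ℕ` with `m − 2Lρ < −n` the function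
`ξ ↦ (−Δ_ξ)^L σ(x,ξ)` is integrable; there is a kernel `k(x,z)`, given for `z ≠ 0`
(independently of the choice of such `L`) by
`k(x,z) = (2π)^{−n} |z|^{−2L} ∫ e^{i z·ξ} (−Δ_ξ)^L σ(x,ξ) dξ`, which is smooth on `{z ≠ 0}`
and satisfies, for all multi-indices `α, β` and every `N > 0`,
`|∂_x^α ∂_z^β k(x,z)| ≤ C_{α,β,N} (1+|z|)^{−N}` whenever `|z| ≥ 1/2`. -/
theorem stmt_10 (n : ℕ) (hn : 1 ≤ n) (m ρ δ : ℝ) (hρ : 0 < ρ) (hδ : 0 ≤ δ)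
    (σ : En n × En n → ℂ) (hσ : IsHormander n m ρ δ σ) :
    (∀ L : ℕ, m - 2 * L * ρ < -(n : ℝ) → ∀ x : En n,
      Integrable fun ξ : En n => (negLapXi n)^[L] σ (x, ξ)) ∧
    ∃ k : En n × En n → ℂ,
      (∀ L : ℕ, m - 2 * L * ρ < -(n : ℝ) → ∀ x z : En n, z ≠ 0 →
        k (x, z) = ((((2 * Real.pi) ^ n)⁻¹ : ℝ) : ℂ) * (((‖z‖ ^ (2 * L))⁻¹ : ℝ) : ℂ) *
          ∫ ξ : En n, Complex.exp (Complex.I * ((⟪z, ξ⟫ : ℝ) : ℂ)) *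
            (negLapXi n)^[L] σ (x, ξ)) ∧
      ContDiffOn ℝ (⊤ : ℕ∞) k {p : En n × En n | p.2 ≠ 0} ∧
      ∀ (α β : Fin n → ℕ) (N : ℝ), 0 < N → ∃ C : ℝ, ∀ x z : En n, (1 / 2 : ℝ) ≤ ‖z‖ →
        ‖mixD n α β k (x, z)‖ ≤ C * (1 + ‖z‖) ^ (-N) := by
  have hS := hσ.symC
  obtain ⟨L0, hL0⟩ := exists_L (n := n) m hρ 0
  have hL0' : m - 2 * L0 * ρ < -(n : ℝ) := by simpa using hL0 L0 le_rfl
  refine ⟨fun L hL x => (hS.iter L).ac.integrable_slice hL x, kL n σ L0, ?_, ?_, ?_⟩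
  · intro L hL x z hz
    exact kL_eq (p := (x, z)) hS hρ hL0' hL hz
  · rw [contDiffOn_infty]
    intro r
    obtain ⟨L1, hL1⟩ := exists_L (n := n) m hρ (((r + 1 : ℕ) : ℝ) * (1 + δ))
    have h1 := hL1 L1 le_rfl
    have h1' : m - 2 * L1 * ρ < -(n : ℝ) := by
      have : 0 ≤ ((r + 1 : ℕ) : ℝ) * (1 + δ) := by positivity
      linarith
    exact (gg_kL hS hδ h1).contDiffOn.congr fun p hp => kL_eq hS hρ hL0' h1' hp
  · intro α β N hN
    set l : List (Fin n ⊕ Fin n) := dirList α Sum.inl ++ dirList β Sum.inr with hl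
    obtain ⟨L1, hL1⟩ := exists_L (n := n) m hρ ((l.length : ℝ) * (1 + δ))
    obtain ⟨L2, hL2⟩ := exists_nat_ge N
    have h1 := hL1 (max L1 L2) (le_max_left _ _)
    generalize hLm : max L1 L2 = L at h1
    have hNL : N ≤ L := hL2.trans (by rw [← hLm]; exact_mod_cast le_max_right _ _)
    have h1' : m - 2 * L * ρ < -(n : ℝ) := by
      have : 0 ≤ (l.length : ℝ) * (1 + δ) := by positivity
      linarith
    have hG : GG n (2 * L) l.length (kL n σ L0) :=
      (gg_kL hS hδ h1).congr fun p hp => kL_eq hS hρ h1' hL0' hp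
    obtain ⟨C, hC0, hC⟩ := GG.pdSeq_bd l hG le_rfl
    refine ⟨C * 3 ^ (2 * L), fun x z hz => ?_⟩
    have e : mixD n α β (kL n σ L0) = pdSeq (l.map (bdir n)) (kL n σ L0) := by
      rw [hl, List.map_append, dirList_map, dirList_map]
      rfl
    rw [e]
    refine (hC (x, z) hz).trans ?_
    rw [mul_assoc]
    refine mul_le_mul_of_nonneg_left ?_ hC0
    change (‖z‖ ^ (2 * L))⁻¹ ≤ _
    have hz0 : 0 < ‖z‖ := by linarith
    have hb : (1 + ‖z‖) ^ N ≤ (3 * ‖z‖) ^ (2 * L) := by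
      calc (1 + ‖z‖) ^ N ≤ (1 + ‖z‖) ^ (((2 * L : ℕ) : ℝ)) := by
            refine Real.rpow_le_rpow_of_exponent_le (by linarith) ?_
            push_cast
            linarith
        _ = (1 + ‖z‖) ^ (2 * L) := Real.rpow_natCast _ _
        _ ≤ _ := by
            gcongr
            linarith
    rw [Real.rpow_neg (by positivity), ← div_eq_mul_inv,
      inv_le_iff_one_le_mul₀ (by positivity), div_mul_eq_mul_div, ← mul_pow,
      one_le_div (by positivity)]
    exact hb
end
end

section
/- Let m ∈ ℝ, ρ, δ ≥ 0, and let σ ∈ S^m_{ρ,δ}. Let α, β be nonnegative integers, and let Φ, Ψ be Schwartz functions on ℝⁿ of the form Φ = ∂_{x₁}^α Φ_α and Ψ = ∂_{ξ₁}^β Ψ_β for some Schwartz functions Φ_α, Ψ_β on ℝⁿ. Then there exists a constant C such that for all integers j, j′ ≥ 0 and all k, k′ ∈ ℤⁿ: |∫_{ℝⁿ}∫_{ℝⁿ} σ(x,ξ) · 2^{nj/2} Φ(2^j x − k) · 2^{nj′/2} Ψ(2^{j′} ξ − k′) dx dξ| ≤ C 2^{−(n/2+α)j} 2^{−(n/2+β)j′}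 (1+2^{−j′}|k′|)^{m + δα − ρβ}. -/
open MeasureTheory Complex
open scoped RealInnerProductSpace ENNReal NNReal

noncomputable section

open scoped LineDeriv

lemma aux_pdSeq_contDiff {V : Type*} [NormedAddCommGroup V] [NormedSpace ℝ V] (L : List V)
    (f : V → ℂ) (hf : ContDiff ℝ (⊤ : ℕ∞) f) : ContDiff ℝ (⊤ : ℕ∞) (pdSeq L f) := by
  induction L with
  | nil => exact hf
  | cons v L ih =>
    change ContDiff ℝ (⊤ : ℕ∞) (fun x => fderiv ℝ (pdSeq L f) x v)
    exact (ih.fderiv_right (by simp)).clm_apply contDiff_const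

lemma aux_pdSeq_schwartz {n : ℕ} (v : En n) (p : ℕ) (f : SchwartzMap (En n) ℂ) :
    ∃ g : SchwartzMap (En n) ℂ, ⇑g = pdSeq (List.replicate p v) (⇑f) := by
  induction p with
  | zero => exact ⟨f, rfl⟩
  | succ p ih =>
    obtain ⟨g, hg⟩ := ih
    refine ⟨∂_{v} g, ?_⟩
    funext x
    rw [SchwartzMap.lineDerivOp_apply_eq_fderiv, hg]
    rfl

lemma aux_rescale {n : ℕ} (a : ℝ) (ha : a ≠ 0) (k : En n) (f : SchwartzMap (En n) ℂ) :
    ∃ g : SchwartzMap (En n) ℂ, ∀ x, g x = f (a • x - k) := by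
  refine ⟨SchwartzMap.compCLMOfContinuousLinearEquiv ℂ
    (ContinuousLinearEquiv.smulLeft (Units.mk0 a ha))
    (SchwartzMap.compSubConstCLM ℂ k f), fun x => ?_⟩
  rfl

lemma aux_pdSeq_rescale {n : ℕ} (a : ℝ) (k v : En n) (p : ℕ)
    (f g : SchwartzMap (En n) ℂ) (hg : ∀ x, g x = f (a • x - k)) (x : En n) :
    pdSeq (List.replicate p v) (⇑g) x
      = (a : ℂ) ^ p * pdSeq (List.replicate p v) (⇑f) (a • x - k) := by
  induction p generalizing x with
  | zero => simpa [pdSeq] using hg x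
  | succ p ih =>
    obtain ⟨F, hF⟩ := aux_pdSeq_schwartz v p f
    have h1 : pdSeq (List.replicate p v) (⇑g) = fun x => (a : ℂ) ^ p * F (a • x - k) := by
      funext y; rw [ih y, hF]
    change fderiv ℝ (pdSeq (List.replicate p v) (⇑g)) x v
      = (a : ℂ) ^ (p + 1) * fderiv ℝ (pdSeq (List.replicate p v) (⇑f)) (a • x - k) v
    rw [h1, ← hF]
    have h2 : HasFDerivAt (fun x : En n => a • x - k) (a • ContinuousLinearMap.id ℝ (En n)) x :=
      ((hasFDerivAt_id x).const_smul a).sub_const k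
    have h3 : HasFDerivAt (⇑F) (fderiv ℝ (⇑F) (a • x - k)) (a • x - k) :=
      F.differentiableAt.hasFDerivAt
    have h4 := (h3.comp x h2).const_mul ((a : ℂ) ^ p)
    have h5 : fderiv ℝ (fun x => (a : ℂ) ^ p * F (a • x - k)) x = _ := h4.fderiv
    rw [h5]
    simp
    ring

lemma aux_flatten_nil {V : Type*} (n : ℕ) (dir : Fin n → V) :
    (List.ofFn fun i : Fin n => List.replicate 0 (dir i)).flatten = [] := by
  induction n with
  | zero => simp
  | succ n ih =>
    rw [List.ofFn_succ]
    simp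

lemma aux_dirList {V : Type*} {n : ℕ} (hn : 0 < n) (p : ℕ) (dir : Fin n → V) :
    dirList (Pi.single ⟨0, hn⟩ p) dir = List.replicate p (dir ⟨0, hn⟩) := by
  obtain ⟨n, rfl⟩ : ∃ l, n = l + 1 := ⟨n - 1, by omega⟩
  unfold dirList
  rw [List.ofFn_succ]
  have h : (fun i : Fin n => List.replicate
      ((Pi.single (⟨0, hn⟩ : Fin (n+1)) p : Fin (n+1) → ℕ) i.succ) (dir i.succ))
      = fun i : Fin n => List.replicate 0 (dir i.succ) := by
    funext i
    rw [Pi.single_eq_of_ne]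
    exact Fin.succ_ne_zero i
  rw [List.flatten_cons, h, aux_flatten_nil n (fun i => dir i.succ), List.append_nil]
  have h0 : (⟨0, hn⟩ : Fin (n+1)) = 0 := rfl
  rw [h0, Pi.single_eq_same]

/-- Mixed derivatives in the first coordinates. -/
def auxS (n : ℕ) (e : En n) (σ : En n × En n → ℂ) (p q : ℕ) : En n × En n → ℂ :=
  pdSeq (List.replicate p (e, (0 : En n)) ++ List.replicate q ((0 : En n), e)) σ

lemma aux_bound (n : ℕ) (hn : 0 < n) (m ρ δ : ℝ) (σ : En n × En n → ℂ)
    (hσ : IsHormander n m ρ δ σ) (p q : ℕ) :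
    ∃ C : ℝ, 0 ≤ C ∧ ∀ X : En n × En n, ‖auxS n (unitE n ⟨0, hn⟩) σ p q X‖ ≤
      C * (1 + ‖X.2‖) ^ (m + δ * p - ρ * q) := by
  obtain ⟨C, hC⟩ := hσ.2 (Pi.single ⟨0, hn⟩ p) (Pi.single ⟨0, hn⟩ q)
  refine ⟨|C|, abs_nonneg C, fun X => ?_⟩
  have h := hC X.1 X.2
  have hs : ∀ r : ℕ, ∑ i, (((Pi.single (⟨0, hn⟩ : Fin n) r : Fin n → ℕ) i : ℕ) : ℝ) = r := by
    intro r
    rw [← Nat.cast_sum, Finset.sum_pi_single']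
    simp
  rw [hs, hs, mixD, aux_dirList hn, aux_dirList hn] at h
  have he : m - ρ * q + δ * p = m + δ * p - ρ * q := by ring
  rw [he] at h
  refine le_trans h ?_
  gcongr
  exact le_abs_self C

lemma aux_weight_int {n : ℕ} (t : ℝ) (f : SchwartzMap (En n) ℂ) :
    Integrable (fun x : En n => (1 + ‖x‖) ^ t * ‖f x‖) := by
  obtain ⟨N, hN⟩ := exists_nat_ge t
  have h1 : Integrable (fun x : En n => ‖f x‖) := f.integrable.norm
  have h2 : Integrable (fun x : En n => ‖x‖ ^ N * ‖f x‖) := f.integrable_pow_mul volume N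
  refine ((h1.add h2).const_mul ((2 : ℝ) ^ (N - 1))).mono' ?_ (Filter.Eventually.of_forall ?_)
  · refine Continuous.aestronglyMeasurable ?_
    refine Continuous.mul ?_ f.continuous.norm
    refine Continuous.rpow_const (by fun_prop) (fun x => Or.inl ?_)
    positivity
  · intro x
    rw [Real.norm_of_nonneg (by positivity)]
    have h3 : (1 + ‖x‖) ^ t ≤ (1 + ‖x‖) ^ N := by
      rw [← Real.rpow_natCast]
      exact Real.rpow_le_rpow_of_exponent_le (by linarith [norm_nonneg x]) hN
    have h4 := add_pow_le (zero_le_one' ℝ) (norm_nonneg x) N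
    rw [one_pow] at h4
    calc (1 + ‖x‖) ^ t * ‖f x‖ ≤ (2 ^ (N - 1) * (1 + ‖x‖ ^ N)) * ‖f x‖ := by
          gcongr; exact h3.trans h4
      _ = 2 ^ (N - 1) * (‖f x‖ + ‖x‖ ^ N * ‖f x‖) := by ring

lemma aux_dom {n : ℕ} (C t : ℝ) (φ ψ : SchwartzMap (En n) ℂ) :
    Integrable (fun X : En n × En n => C * (‖φ X.1‖ * ((1 + ‖X.2‖) ^ t * ‖ψ X.2‖))) :=
  (φ.integrable.norm.mul_prod (aux_weight_int t ψ)).const_mul C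

lemma aux_le {n : ℕ} (g : En n × En n → ℂ) (C t : ℝ)
    (hb : ∀ X, ‖g X‖ ≤ C * (1 + ‖X.2‖) ^ t) (φ ψ : SchwartzMap (En n) ℂ) (X : En n × En n) :
    ‖g X * (φ X.1 * ψ X.2)‖ ≤ C * (‖φ X.1‖ * ((1 + ‖X.2‖) ^ t * ‖ψ X.2‖)) := by
  rw [norm_mul, norm_mul]
  calc _ ≤ (C * (1 + ‖X.2‖) ^ t) * (‖φ X.1‖ * ‖ψ X.2‖) := by
        gcongr; exact hb X
    _ = _ := by ring

lemma aux_int {n : ℕ} (g : En n × En n → ℂ) (hg : Continuous g) (C t : ℝ)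
    (hb : ∀ X, ‖g X‖ ≤ C * (1 + ‖X.2‖) ^ t) (φ ψ : SchwartzMap (En n) ℂ) :
    Integrable (fun X : En n × En n => g X * (φ X.1 * ψ X.2)) := by
  refine (aux_dom C t φ ψ).mono' ?_ (Filter.Eventually.of_forall (aux_le g C t hb φ ψ))
  refine Continuous.aestronglyMeasurable ?_
  have h1 := φ.continuous
  have h2 := ψ.continuous
  fun_prop

lemma aux_parts {n : ℕ} (σ : En n × En n → ℂ) (e : En n) (hσ : ContDiff ℝ (⊤ : ℕ∞) σ)
    (hb : ∀ p q, ∃ C t : ℝ, ∀ X : En n × En n, ‖auxS n e σ p q X‖ ≤ C * (1 + ‖X.2‖) ^ t)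
    (α β : ℕ) (φ ψ : SchwartzMap (En n) ℂ) :
    ∫ X : En n × En n, σ X * (pdSeq (List.replicate α e) (⇑φ) X.1 *
        pdSeq (List.replicate β e) (⇑ψ) X.2)
      = (-1) ^ (α + β) * ∫ X : En n × En n, auxS n e σ α β X * (φ X.1 * ψ X.2) := by
  haveI hHaar : (volume : Measure (En n × En n)).IsAddHaarMeasure :=
    inferInstanceAs ((volume : Measure (En n)).prod (volume : Measure (En n))).IsAddHaarMeasure
  have hS : ∀ p q, ContDiff ℝ (⊤ : ℕ∞) (auxS n e σ p q) := fun p q =>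
    aux_pdSeq_contDiff _ σ hσ
  have hI : ∀ p q (φ ψ : SchwartzMap (En n) ℂ),
      Integrable (fun X : En n × En n => auxS n e σ p q X * (φ X.1 * ψ X.2)) := by
    intro p q φ ψ
    obtain ⟨C, t, h⟩ := hb p q
    exact aux_int _ (hS p q).continuous C t h φ ψ
  have hG : ∀ (φ ψ : SchwartzMap (En n) ℂ) (X : En n × En n),
      HasFDerivAt (fun X : En n × En n => φ X.1 * ψ X.2)
        (φ X.1 • ((fderiv ℝ (⇑ψ) X.2).comp (ContinuousLinearMap.snd ℝ (En n) (En n)))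
        + ψ X.2 • ((fderiv ℝ (⇑φ) X.1).comp (ContinuousLinearMap.fst ℝ (En n) (En n)))) X := by
    intro φ ψ X
    have h1 : HasFDerivAt (fun X : En n × En n => φ X.1) _ X :=
      (φ.differentiableAt (x := X.1)).hasFDerivAt.comp X hasFDerivAt_fst
    have h2 : HasFDerivAt (fun X : En n × En n => ψ X.2) _ X :=
      (ψ.differentiableAt (x := X.2)).hasFDerivAt.comp X hasFDerivAt_snd
    exact h1.mul h2
  have hGx : ∀ (φ ψ : SchwartzMap (En n) ℂ) (X : En n × En n),
      fderiv ℝ (fun X : En n × En n => φ X.1 * ψ X.2) X (e, 0) = (∂_{e} φ) X.1 * ψ X.2 := by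
    intro φ ψ X
    rw [(hG φ ψ X).fderiv, SchwartzMap.lineDerivOp_apply_eq_fderiv]
    simp [mul_comm]
  have hGy : ∀ (φ ψ : SchwartzMap (En n) ℂ) (X : En n × En n),
      fderiv ℝ (fun X : En n × En n => φ X.1 * ψ X.2) X (0, e) = φ X.1 * (∂_{e} ψ) X.2 := by
    intro φ ψ X
    rw [(hG φ ψ X).fderiv, SchwartzMap.lineDerivOp_apply_eq_fderiv]
    simp
  have hx : ∀ p q (φ ψ : SchwartzMap (En n) ℂ),
      ∫ X : En n × En n, auxS n e σ p q X * ((∂_{e} φ) X.1 * ψ X.2)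
        = - ∫ X : En n × En n, auxS n e σ (p + 1) q X * (φ X.1 * ψ X.2) := by
    intro p q φ ψ
    have h := integral_mul_fderiv_eq_neg_fderiv_mul_of_integrable (𝕜 := ℂ)
      (μ := (volume : Measure (En n × En n)))
      (f := auxS n e σ p q) (g := fun X : En n × En n => φ X.1 * ψ X.2) (v := (e, 0))
      (hI (p + 1) q φ ψ) (by simp_rw [hGx]; exact hI p q _ ψ) (hI p q φ ψ)
      (fun X _ => ((hS p q).differentiable (by simp)) X)
      (fun X _ => (hG φ ψ X).differentiableAt)
    simp_rw [hGx] at h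
    exact h
  have hy : ∀ q (φ ψ : SchwartzMap (En n) ℂ),
      ∫ X : En n × En n, auxS n e σ 0 q X * (φ X.1 * (∂_{e} ψ) X.2)
        = - ∫ X : En n × En n, auxS n e σ 0 (q + 1) X * (φ X.1 * ψ X.2) := by
    intro q φ ψ
    have h := integral_mul_fderiv_eq_neg_fderiv_mul_of_integrable (𝕜 := ℂ)
      (μ := (volume : Measure (En n × En n)))
      (f := auxS n e σ 0 q) (g := fun X : En n × En n => φ X.1 * ψ X.2) (v := (0, e))
      (hI 0 (q + 1) φ ψ) (by simp_rw [hGy]; exact hI 0 q φ _) (hI 0 q φ ψ)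
      (fun X _ => ((hS 0 q).differentiable (by simp)) X)
      (fun X _ => (hG φ ψ X).differentiableAt)
    simp_rw [hGy] at h
    exact h
  have step : ∀ (r : ℕ) (χ : SchwartzMap (En n) ℂ), ∃ g : SchwartzMap (En n) ℂ,
      ⇑g = pdSeq (List.replicate r e) (⇑χ) ∧
      ⇑(∂_{e} g : SchwartzMap (En n) ℂ) = pdSeq (List.replicate (r + 1) e) (⇑χ) := by
    intro r χ
    obtain ⟨g, hg⟩ := aux_pdSeq_schwartz e r χ
    refine ⟨g, hg, ?_⟩
    funext x
    rw [SchwartzMap.lineDerivOp_apply_eq_fderiv, hg]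
    rfl
  have hyy : ∀ (β q : ℕ) (φ ψ : SchwartzMap (En n) ℂ),
      ∫ X : En n × En n, auxS n e σ 0 q X * (φ X.1 * pdSeq (List.replicate β e) (⇑ψ) X.2)
        = (-1) ^ β * ∫ X : En n × En n, auxS n e σ 0 (q + β) X * (φ X.1 * ψ X.2) := by
    intro β
    induction β with
    | zero => intro q φ ψ; simp [pdSeq]
    | succ β ih =>
      intro q φ ψ
      obtain ⟨g, hg, hg'⟩ := step β ψ
      rw [← hg', hy, hg, ih]
      rw [show q + 1 + β = q + (β + 1) by ring, pow_succ]
      ring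
  have hxx : ∀ (α p q : ℕ) (φ ψ : SchwartzMap (En n) ℂ),
      ∫ X : En n × En n, auxS n e σ p q X * (pdSeq (List.replicate α e) (⇑φ) X.1 * ψ X.2)
        = (-1) ^ α * ∫ X : En n × En n, auxS n e σ (p + α) q X * (φ X.1 * ψ X.2) := by
    intro α
    induction α with
    | zero => intro p q φ ψ; simp [pdSeq]
    | succ α ih =>
      intro p q φ ψ
      obtain ⟨g, hg, hg'⟩ := step α φ
      rw [← hg', hx, hg, ih]
      rw [show p + 1 + α = p + (α + 1) by ring, pow_succ]
      ring
  obtain ⟨g, hg⟩ := aux_pdSeq_schwartz e α φ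
  have h1 := hyy β 0 g ψ
  rw [hg, zero_add, hxx, zero_add] at h1
  refine Eq.trans ?_ (h1.trans ?_)
  · rfl
  · rw [pow_add]; ring

lemma aux_peetre {n : ℕ} (s : ℝ) (u v : En n) :
    (1 + ‖u + v‖) ^ s ≤ (1 + ‖u‖) ^ s * (1 + ‖v‖) ^ |s| := by
  have hu := norm_nonneg u
  have hv := norm_nonneg v
  have huv := norm_nonneg (u + v)
  rcases le_total 0 s with hs | hs
  · rw [abs_of_nonneg hs, ← Real.mul_rpow (by positivity) (by positivity)]
    refine Real.rpow_le_rpow (by positivity) ?_ hs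
    nlinarith [norm_add_le u v, mul_nonneg hu hv]
  · rw [abs_of_nonpos hs]
    have h1 : (1 + ‖u‖) ≤ (1 + ‖u + v‖) * (1 + ‖v‖) := by
      have : ‖u‖ ≤ ‖u + v‖ + ‖v‖ := by
        simpa using norm_sub_le (u + v) v
      nlinarith [mul_nonneg huv hv]
    have h2 : (1 + ‖u‖) ^ (-s) ≤ (1 + ‖u + v‖) ^ (-s) * (1 + ‖v‖) ^ (-s) := by
      rw [← Real.mul_rpow (by positivity) (by positivity)]
      exact Real.rpow_le_rpow (by positivity) h1 (by linarith)
    have h3 : (1 + ‖u‖) ^ s * (1 + ‖u‖) ^ (-s) = 1 := by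
      rw [← Real.rpow_add (by positivity)]; simp
    have h4 : (1 + ‖u + v‖) ^ s * (1 + ‖u + v‖) ^ (-s) = 1 := by
      rw [← Real.rpow_add (by positivity)]; simp
    have p1 : 0 ≤ (1 + ‖u‖) ^ s := by positivity
    have p2 : 0 ≤ (1 + ‖u + v‖) ^ s := by positivity
    calc (1 + ‖u + v‖) ^ s = (1 + ‖u + v‖) ^ s * (1 + ‖u‖) ^ s * (1 + ‖u‖) ^ (-s) := by
          rw [mul_assoc, h3, mul_one]
      _ ≤ (1 + ‖u + v‖) ^ s * (1 + ‖u‖) ^ s * ((1 + ‖u + v‖) ^ (-s) * (1 + ‖v‖) ^ (-s)) := by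
          gcongr
      _ = ((1 + ‖u + v‖) ^ s * (1 + ‖u + v‖) ^ (-s)) * (1 + ‖u‖) ^ s * (1 + ‖v‖) ^ (-s) := by
          ring
      _ = _ := by rw [h4, one_mul]

lemma aux_cov {n : ℕ} (W : En n → ℝ) (a : ℝ) (ha : 0 < a) (k : En n) :
    ∫ x : En n, W (a • x - k) = (a ^ n)⁻¹ * ∫ x : En n, W x := by
  have h := Measure.integral_comp_smul (volume : Measure (En n)) (fun y => W (y - k)) a
  rw [h, integral_sub_right_eq_self, smul_eq_mul, abs_of_pos (by positivity)]
  simp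

lemma aux_cov_int {n : ℕ} (W : En n → ℝ) (hW : Integrable W) (a : ℝ) (ha : 0 < a) (k : En n) :
    Integrable (fun x : En n => W (a • x - k)) :=
  (hW.comp_sub_right k).comp_smul ha.ne'

lemma aux_xi {n : ℕ} (s b : ℝ) (hb : 1 ≤ b) (k : En n) (f g : SchwartzMap (En n) ℂ)
    (hg : ∀ x, g x = f (b • x - k)) :
    ∫ x : En n, (1 + ‖x‖) ^ s * ‖g x‖ ≤
      (1 + b⁻¹ * ‖k‖) ^ s * ((b ^ n)⁻¹ * ∫ x : En n, (1 + ‖x‖) ^ |s| * ‖f x‖) := by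
  have hb0 : 0 < b := by linarith
  rw [← aux_cov _ b hb0 k, ← integral_const_mul]
  refine integral_mono (aux_weight_int s g)
    ((aux_cov_int _ (aux_weight_int |s| f) b hb0 k).const_mul _) (fun x => ?_)
  have h1 := aux_peetre s (b⁻¹ • k) (b⁻¹ • (b • x - k))
  have h2 : b⁻¹ • k + b⁻¹ • (b • x - k) = x := by
    rw [smul_sub, smul_smul, inv_mul_cancel₀ hb0.ne', one_smul]; abel
  have h3 : ‖b⁻¹ • k‖ = b⁻¹ * ‖k‖ := by
    rw [norm_smul, Real.norm_of_nonneg (by positivity)]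
  have h4 : ‖b⁻¹ • (b • x - k)‖ ≤ ‖b • x - k‖ := by
    rw [norm_smul, Real.norm_of_nonneg (by positivity)]
    exact mul_le_of_le_one_left (norm_nonneg _) (inv_le_one_of_one_le₀ hb)
  rw [h2, h3] at h1
  change (1 + ‖x‖) ^ s * ‖g x‖ ≤
    (1 + b⁻¹ * ‖k‖) ^ s * ((1 + ‖b • x - k‖) ^ |s| * ‖f (b • x - k)‖)
  rw [hg, ← mul_assoc]
  refine mul_le_mul_of_nonneg_right (h1.trans ?_) (norm_nonneg _)
  refine mul_le_mul_of_nonneg_left ?_ (by positivity)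
  exact Real.rpow_le_rpow (by positivity) (by linarith) (abs_nonneg s)

lemma aux_pow (n j α : ℕ) :
    (2 : ℝ) ^ ((n * j : ℝ) / 2) * (((2 : ℝ) ^ j) ^ α)⁻¹ * (((2 : ℝ) ^ j) ^ n)⁻¹
      = (2 : ℝ) ^ ((-(n : ℝ) / 2 - α) * j) := by
  rw [← pow_mul, ← pow_mul, ← Real.rpow_natCast, ← Real.rpow_natCast, ← Real.rpow_neg (by norm_num),
    ← Real.rpow_neg (by norm_num), ← Real.rpow_add (by norm_num), ← Real.rpow_add (by norm_num)]
  congr 1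
  push_cast
  ring

/-- Let `σ ∈ S^m_{ρ,δ}` and let `Φ = ∂_{x₁}^α Φ_α`, `Ψ = ∂_{ξ₁}^β Ψ_β` for Schwartz
`Φ_α, Ψ_β`.  Then there is `C` such that for all `j, j′ ≥ 0` and `k, k′ ∈ ℤⁿ`,
`|∫∫ σ(x,ξ) 2^{nj/2} Φ(2^j x−k) 2^{nj′/2} Ψ(2^{j′} ξ−k′) dx dξ|
  ≤ C 2^{−(n/2+α)j} 2^{−(n/2+β)j′} (1+2^{−j′}|k′|)^{m+δα−ρβ}`. -/
theorem stmt_16 (n : ℕ) (hn : 0 < n) (m ρ δ : ℝ) (hρ : 0 ≤ ρ) (hδ : 0 ≤ δ)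
    (σ : En n × En n → ℂ) (hσ : IsHormander n m ρ δ σ)
    (α β : ℕ) (Φα Ψβ : SchwartzMap (En n) ℂ) :
    ∃ C : ℝ, ∀ (j j' : ℕ) (k k' : Fin n → ℤ),
      ‖∫ ξ : En n, ∫ x : En n, σ (x, ξ) *
          ((((2 : ℝ) ^ ((n * j : ℝ) / 2) : ℝ) : ℂ) *
            pdSeq (List.replicate α (unitE n ⟨0, hn⟩)) (⇑Φα)
              ((2 : ℝ) ^ j • x - intVec n k)) *
          ((((2 : ℝ) ^ ((n * j' : ℝ) / 2) : ℝ) : ℂ) *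
            pdSeq (List.replicate β (unitE n ⟨0, hn⟩)) (⇑Ψβ)
              ((2 : ℝ) ^ j' • ξ - intVec n k'))‖ ≤
        C * (2 : ℝ) ^ ((-(n : ℝ) / 2 - α) * j) * (2 : ℝ) ^ ((-(n : ℝ) / 2 - β) * j') *
          (1 + (2 : ℝ) ^ (-(j' : ℝ)) * ‖intVec n k'‖) ^ (m + δ * α - ρ * β) := by
  set e := unitE n ⟨0, hn⟩ with he
  set s : ℝ := m + δ * α - ρ * β with hs
  obtain ⟨C0, hC0, hbd⟩ := aux_bound n hn m ρ δ σ hσ α β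
  rw [← he, ← hs] at hbd
  have hb : ∀ p q, ∃ C t : ℝ, ∀ X : En n × En n,
      ‖auxS n e σ p q X‖ ≤ C * (1 + ‖X.2‖) ^ t := by
    intro p q
    obtain ⟨C, _, h⟩ := aux_bound n hn m ρ δ σ hσ p q
    exact ⟨C, _, h⟩
  refine ⟨C0 * (∫ x : En n, ‖Φα x‖) * ∫ x : En n, (1 + ‖x‖) ^ |s| * ‖Ψβ x‖, ?_⟩
  intro j j' k k'
  set a : ℝ := (2 : ℝ) ^ j with ha
  set b : ℝ := (2 : ℝ) ^ j' with hbb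
  have ha1 : 1 ≤ a := one_le_pow₀ (by norm_num)
  have hb1 : 1 ≤ b := one_le_pow₀ (by norm_num)
  have ha0 : 0 < a := by linarith
  have hb0 : 0 < b := by linarith
  obtain ⟨φ, hφ⟩ := aux_rescale a ha0.ne' (intVec n k) Φα
  obtain ⟨ψ, hψ⟩ := aux_rescale b hb0.ne' (intVec n k') Ψβ
  have hac : (a : ℂ) ≠ 0 := by exact_mod_cast ha0.ne'
  have hbc : (b : ℂ) ≠ 0 := by exact_mod_cast hb0.ne'
  set A : ℝ := (2 : ℝ) ^ ((n * j : ℝ) / 2) * (a ^ α)⁻¹ with hA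
  set B : ℝ := (2 : ℝ) ^ ((n * j' : ℝ) / 2) * (b ^ β)⁻¹ with hB
  have hA0 : 0 ≤ A := by positivity
  have hB0 : 0 ≤ B := by positivity
  set F : En n × En n → ℂ := fun X => σ X * (pdSeq (List.replicate α e) (⇑φ) X.1 *
        pdSeq (List.replicate β e) (⇑ψ) X.2) with hF
  have hpt : ∀ ξ x : En n, σ (x, ξ) *
          ((((2 : ℝ) ^ ((n * j : ℝ) / 2) : ℝ) : ℂ) *
            pdSeq (List.replicate α e) (⇑Φα) (a • x - intVec n k)) *
          ((((2 : ℝ) ^ ((n * j' : ℝ) / 2) : ℝ) : ℂ) *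
            pdSeq (List.replicate β e) (⇑Ψβ) (b • ξ - intVec n k'))
      = ((A * B : ℝ) : ℂ) * F (x, ξ) := by
    intro ξ x
    simp only [hF, hA, hB]
    rw [aux_pdSeq_rescale a (intVec n k) e α Φα φ hφ,
      aux_pdSeq_rescale b (intVec n k') e β Ψβ ψ hψ]
    push_cast
    field_simp
  have hFint : Integrable F := by
    obtain ⟨g1, hg1⟩ := aux_pdSeq_schwartz e α φ
    obtain ⟨g2, hg2⟩ := aux_pdSeq_schwartz e β ψ
    obtain ⟨C, t, h⟩ := hb 0 0
    rw [hF, ← hg1, ← hg2]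
    exact aux_int σ hσ.1.continuous C t h g1 g2
  have hmain : ‖∫ X, F X‖ ≤ C0 * ((a ^ n)⁻¹ * ∫ x : En n, ‖Φα x‖) *
      ((1 + b⁻¹ * ‖intVec n k'‖) ^ s *
        ((b ^ n)⁻¹ * ∫ x : En n, (1 + ‖x‖) ^ |s| * ‖Ψβ x‖)) := by
    rw [hF, aux_parts σ e hσ.1 hb α β φ ψ, norm_mul, norm_pow, norm_neg, norm_one, one_pow,
      one_mul]
    refine (norm_integral_le_of_norm_le (aux_dom C0 s φ ψ)
      (Filter.Eventually.of_forall (aux_le _ C0 s hbd φ ψ))).trans ?_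
    rw [integral_const_mul]
    have h1 : ∫ X : En n × En n, (‖φ X.1‖ * ((1 + ‖X.2‖) ^ s * ‖ψ X.2‖))
        = (∫ x : En n, ‖φ x‖) * ∫ x : En n, (1 + ‖x‖) ^ s * ‖ψ x‖ :=
      integral_prod_mul (μ := (volume : Measure (En n))) (ν := (volume : Measure (En n)))
        (fun x : En n => ‖φ x‖) (fun x : En n => (1 + ‖x‖) ^ s * ‖ψ x‖)
    have h2 : ∫ x : En n, ‖φ x‖ = (a ^ n)⁻¹ * ∫ x : En n, ‖Φα x‖ := by
      rw [← aux_cov _ a ha0 (intVec n k)]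
      simp_rw [hφ]
    have h3 : 0 ≤ ∫ x : En n, ‖Φα x‖ := integral_nonneg fun x => norm_nonneg _
    rw [h1, h2, ← mul_assoc]
    exact mul_le_mul_of_nonneg_left (aux_xi s b hb1 _ Ψβ ψ hψ) (by positivity)
  have hfub : ∫ ξ : En n, ∫ x : En n, F (x, ξ) = ∫ X, F X :=
    (integral_prod_symm (μ := (volume : Measure (En n))) (ν := (volume : Measure (En n)))
      F hFint).symm
  simp_rw [hpt, integral_const_mul]
  rw [hfub, norm_mul, Complex.norm_real, Real.norm_of_nonneg (by positivity)]
  have hbi : (2 : ℝ) ^ (-(j' : ℝ)) = b⁻¹ := by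
    rw [Real.rpow_neg (by norm_num), Real.rpow_natCast]
  rw [hbi, ← aux_pow n j α, ← aux_pow n j' β, ← ha, ← hbb, ← hA, ← hB]
  refine (mul_le_mul_of_nonneg_left hmain (by positivity)).trans (le_of_eq ?_)
  ring
end
end
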